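/- For every natural number n ≥ 1, the n-th derivative of the function l(x) = (n−1)!·f_n(x)·((2−2n)x − x² − n(n−1)) + x^{n+1} + (n−1)·x^n equals (n−1)!·e^{−x}·(2x − x²) for every real x ≥ 0. -/

import Mathlib

/-- The signed tail of the Taylor series of `e^{-x}`:
`f k x = (-1)^k ∑_{j=k}^∞ (-x)^j / j!`. -/
noncomputable def f (k : ℕ) (x : ℝ) : ℝ :=
  (-1 : ℝ) ^ k * ∑' j : ℕ, (-x) ^ (k + j) / (Nat.factorial (k + j))

/-- `l n x = (n-1)! f_n(x) ((2-2n)x - x² - n(n-1)) + x^{n+1} + (n-1) x^n`. -/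
noncomputable def l (n : ℕ) (x : ℝ) : ℝ :=
  (Nat.factorial (n - 1)) * f n x *
      ((2 - 2 * (n : ℝ)) * x - x ^ 2 - (n : ℝ) * ((n : ℝ) - 1)) +
    x ^ (n + 1) + ((n : ℝ) - 1) * x ^ n

lemma f_zero' (x : ℝ) : f 0 x = Real.exp (-x) := by
  simp [f, Real.exp_eq_exp_ℝ, NormedSpace.exp_eq_tsum_div]

lemma f_succ' (k : ℕ) (x : ℝ) : f (k + 1) x = x ^ k / (Nat.factorial k) - f k x := by
  have hs : Summable (fun j : ℕ => (-x) ^ (k + j) / (Nat.factorial (k + j) : ℝ)) := by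
    have h := (summable_nat_add_iff k).2 (Real.summable_pow_div_factorial (-x))
    simpa [add_comm] using h
  have h1 : ∀ j : ℕ, k + 1 + j = k + (j + 1) := fun j => by omega
  unfold f
  rw [hs.tsum_eq_zero_add]
  simp only [h1, add_zero]
  have h2 : (-1 : ℝ) ^ k * (-x) ^ k = x ^ k := by rw [← mul_pow]; simp
  rw [← h2]
  ring

lemma f_deriv' (k : ℕ) (x : ℝ) : HasDerivAt (f (k + 1)) (f k x) x := by
  induction k with
  | zero =>
    have h0 : f (0 + 1) = fun x => 1 - Real.exp (-x) := by
      funext y; rw [f_succ', f_zero']; simp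
    rw [h0, f_zero']
    have := ((hasDerivAt_id x).neg.exp).const_sub 1
    simpa using this
  | succ k ih =>
    have h0 : f (k + 1 + 1) = fun x => x ^ (k + 1) / (Nat.factorial (k + 1)) - f (k + 1) x := by
      funext y; rw [f_succ']
    rw [h0, f_succ' k x]
    have := ((hasDerivAt_pow (k + 1) x).div_const (Nat.factorial (k + 1) : ℝ)).sub ih
    refine this.congr_deriv ?_
    have hk : (Nat.factorial k : ℝ) ≠ 0 := by positivity
    rw [Nat.factorial_succ]; push_cast
    have : (k : ℝ) + 1 ≠ 0 := by positivity
    field_simp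

lemma p_deriv' (k : ℕ) (x : ℝ) :
    HasDerivAt (fun x : ℝ => x ^ (k + 1) / (Nat.factorial (k + 1) : ℝ))
      (x ^ k / (Nat.factorial k : ℝ)) x := by
  refine ((hasDerivAt_pow (k + 1) x).div_const (Nat.factorial (k + 1) : ℝ)).congr_deriv ?_
  have hk : (Nat.factorial k : ℝ) ≠ 0 := by positivity
  rw [Nat.factorial_succ]; push_cast
  have : (k : ℝ) + 1 ≠ 0 := by positivity
  field_simp

lemma iter' (b c B C : ℝ) (m : ℕ) : ∀ k : ℕ,
    iteratedDeriv m (fun x => f (k + m) x * (b * x - x ^ 2 - c)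
      + B * (x ^ (k + m + 1) / (Nat.factorial (k + m + 1) : ℝ))
      + C * (x ^ (k + m) / (Nat.factorial (k + m) : ℝ))) =
    fun x => f k x * (b * x - x ^ 2 - c) + m * (f (k + 1) x * (b - 2 * x))
      - m * (m - 1) * f (k + 2) x
      + B * (x ^ (k + 1) / (Nat.factorial (k + 1) : ℝ))
      + C * (x ^ k / (Nat.factorial k : ℝ)) := by
  induction m with
  | zero => intro k; funext x; simp
  | succ m ih =>
    intro k
    have e : k + (m + 1) = k + 1 + m := by omega
    rw [iteratedDeriv_succ, e, ih (k + 1)]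
    funext x
    apply HasDerivAt.deriv
    have hq : HasDerivAt (fun x : ℝ => b * x - x ^ 2 - c) (b - 2 * x) x := by
      have := (((hasDerivAt_id x).const_mul b).sub (hasDerivAt_pow 2 x)).sub_const c
      simpa using this
    have hq' : HasDerivAt (fun x : ℝ => b - 2 * x) (-2) x := by
      have := ((hasDerivAt_id x).const_mul 2).const_sub b
      simpa using this
    have := (((((f_deriv' k x).mul hq).add
      (((f_deriv' (k + 1) x).mul hq').const_mul (m : ℝ))).sub
      ((f_deriv' (k + 2) x).const_mul ((m : ℝ) * (m - 1)))).add
      ((p_deriv' (k + 1) x).const_mul B)).add ((p_deriv' k x).const_mul C)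
    refine this.congr_deriv ?_
    push_cast
    ring

theorem stmt_9 (n : ℕ) (hn : 1 ≤ n) (x : ℝ) (hx : 0 ≤ x) :
    iteratedDeriv n (l n) x =
      (Nat.factorial (n - 1)) * Real.exp (-x) * (2 * x - x ^ 2) := by
  obtain ⟨m, rfl⟩ : ∃ m, n = m + 1 := ⟨n - 1, by omega⟩
  have hm : (Nat.factorial m : ℝ) ≠ 0 := by positivity
  have h1 : (m : ℝ) + 1 ≠ 0 := by positivity
  have h2 : (m : ℝ) + 1 + 1 ≠ 0 := by positivity
  have key := iter' (2 - 2 * ((m + 1 : ℕ) : ℝ)) (((m + 1 : ℕ) : ℝ) * (((m + 1 : ℕ) : ℝ) - 1))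
    (((m : ℝ) + 1 + 1) * (m + 1)) ((m : ℝ) * (m + 1)) (m + 1) 0
  have hl : l (m + 1) = fun x => (Nat.factorial m : ℝ) * (fun x => f (0 + (m + 1)) x *
      ((2 - 2 * ((m + 1 : ℕ) : ℝ)) * x - x ^ 2 - (((m + 1 : ℕ) : ℝ) * (((m + 1 : ℕ) : ℝ) - 1)))
      + (((m : ℝ) + 1 + 1) * (m + 1)) *
        (x ^ (0 + (m + 1) + 1) / (Nat.factorial (0 + (m + 1) + 1) : ℝ))
      + ((m : ℝ) * (m + 1)) * (x ^ (0 + (m + 1)) / (Nat.factorial (0 + (m + 1)) : ℝ))) x := by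
    funext y
    simp only [l, zero_add, Nat.add_sub_cancel, Nat.factorial_succ]
    push_cast
    field_simp
    ring
  rw [hl, iteratedDeriv_const_mul_field, key]
  simp only [zero_add, f_succ' 1, f_succ' 0, f_zero', show (2 : ℕ) = 1 + 1 from rfl,
    Nat.add_sub_cancel]
  simp
  ring
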